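/- Let μ > 0, ν ∈ (0,1), t > 0, and let η be real with η > max(ν, 1+ν−μ). Let g(x,t) = x^{μ−1} e^{−x/t}/(Γ(μ) t^{μ}). Then ∫_0^∞ x^{η−1} (d^ν/d(−x)^ν)[ y ↦ y^{μ−1+ν} · (d^ν/d(−y)^ν)( z ↦ z^{1−μ} g(z,t) )(y) ](x) dx = [Γ(η)/Γ(η−ν)] · [Γ(η+μ−1)/Γ(μ)] · t^{η−ν−1}. -/

import Mathlib

open MeasureTheory Real

/-- Density of the squared Bessel process started at 0. -/
noncomputable def sqBesselDensity (μ x t : ℝ) : ℝ :=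
  x ^ (μ - 1) * Real.exp (-x / t) / (Real.Gamma μ * t ^ μ)

/-- Right Riemann–Liouville fractional derivative of order `ν` on `(0,∞)`. -/
noncomputable def rlRightDeriv (ν : ℝ) (h : ℝ → ℝ) (x : ℝ) : ℝ :=
  -(1 / Real.Gamma (1 - ν)) *
    deriv (fun y => ∫ s in Set.Ioi y, (s - y) ^ (-ν) * h s) x

open Set

lemma aux_swap (k : ℝ → ℝ → ℝ) (G : ℝ → ℝ) (hm : Measurable (Function.uncurry k))
    (h0 : ∀ x > 0, ∀ v > 0, 0 ≤ k x v)
    (hi : ∀ v > 0, IntegrableOn (fun x => k x v) (Ioi 0))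
    (hG : ∀ v > 0, ∫ x in Ioi (0:ℝ), k x v = G v) (hGi : IntegrableOn G (Ioi 0)) :
    IntegrableOn (fun x => ∫ v in Ioi (0:ℝ), k x v) (Ioi 0) ∧
      ∫ x in Ioi (0:ℝ), ∫ v in Ioi (0:ℝ), k x v = ∫ v in Ioi (0:ℝ), G v := by
  have hint : Integrable (Function.uncurry k)
      ((volume.restrict (Ioi (0:ℝ))).prod (volume.restrict (Ioi (0:ℝ)))) := by
    rw [integrable_prod_iff' hm.aestronglyMeasurable]
    refine ⟨(ae_restrict_iff' measurableSet_Ioi).2 (ae_of_all _ fun v hv => hi v hv), ?_⟩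
    refine IntegrableOn.congr_fun hGi (fun v hv => ?_) measurableSet_Ioi
    rw [← hG v hv]
    refine setIntegral_congr_fun measurableSet_Ioi (fun x hx => ?_)
    simp only [Function.uncurry]
    rw [Real.norm_of_nonneg (h0 x hx v hv)]
  refine ⟨hint.integral_prod_left, ?_⟩
  rw [integral_integral_swap hint]
  exact setIntegral_congr_fun measurableSet_Ioi hG

lemma aux_gamma_int {s b : ℝ} (hs : 0 < s) (hb : 0 < b) :
    IntegrableOn (fun x : ℝ => x ^ (s - 1) * exp (-(b * x))) (Ioi 0) := by
  have := integrableOn_rpow_mul_exp_neg_mul_rpow (p := 1) (s := s - 1) (by linarith) one_pos hb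
  simpa using this

lemma aux_beta {p q : ℝ} (hp : 0 < p) (hq : 0 < q) :
    IntegrableOn (fun v : ℝ => v ^ (p - 1) * (1 + v) ^ (-(p + q))) (Ioi 0) ∧
      ∫ v in Ioi (0:ℝ), v ^ (p - 1) * (1 + v) ^ (-(p + q)) =
        Gamma p * Gamma q / Gamma (p + q) := by
  have hpq : 0 < p + q := by linarith
  have key := aux_swap
    (fun v y => v ^ (p - 1) * (y ^ (p + q - 1) * exp (-((1 + v) * y))))
    (fun y => Gamma p * (y ^ (q - 1) * exp (-(1 * y))))
    (by unfold Function.uncurry; fun_prop)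
    (fun x hx v hv => by positivity)
    (fun y hy => by
      have := ((aux_gamma_int hp hy).mul_const (y ^ (p + q - 1) * exp (-y)))
      refine IntegrableOn.congr_fun this (fun v hv => ?_) measurableSet_Ioi
      rw [show -((1 + v) * y) = -(y * v) + -y by ring, exp_add]; ring)
    (fun y hy => by
      have := integral_rpow_mul_exp_neg_mul_Ioi hp hy
      calc _ = ∫ v in Ioi (0:ℝ), (y ^ (p + q - 1) * exp (-y)) * (v ^ (p - 1) * exp (-(y * v))) := by
            refine setIntegral_congr_fun measurableSet_Ioi (fun v hv => ?_)
            rw [show -((1 + v) * y) = -(y * v) + -y by ring, exp_add]; ring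
        _ = _ := by
            rw [integral_const_mul, this, one_div, inv_rpow (le_of_lt hy), ← rpow_neg (le_of_lt hy),
              show q - 1 = (p + q - 1) + (-p) by ring, rpow_add hy, one_mul]
            ring)
    ((aux_gamma_int hq one_pos).const_mul _)
  have hin : ∀ v ∈ Ioi (0:ℝ), (∫ y in Ioi (0:ℝ), v ^ (p - 1) * (y ^ (p + q - 1) * exp (-((1 + v) * y))))
      = Gamma (p + q) * (v ^ (p - 1) * (1 + v) ^ (-(p + q))) := by
    intro v hv
    have hv' : (0:ℝ) < 1 + v := by have : (0:ℝ) < v := hv; linarith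
    rw [integral_const_mul, integral_rpow_mul_exp_neg_mul_Ioi hpq hv', one_div,
      inv_rpow hv'.le, ← rpow_neg hv'.le]; ring
  have hG := (Gamma_pos_of_pos hpq).ne'
  obtain ⟨k1, k2⟩ := key
  have k1' := (k1.congr_fun hin measurableSet_Ioi).const_mul (Gamma (p + q))⁻¹
  rw [setIntegral_congr_fun measurableSet_Ioi hin, integral_const_mul, integral_const_mul,
    integral_rpow_mul_exp_neg_mul_Ioi hq one_pos] at k2
  constructor
  · refine IntegrableOn.congr_fun k1' (fun v hv => ?_) measurableSet_Ioi
    field_simp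
  · rw [eq_div_iff hG, mul_comm, k2]; simp

/-- the fractional integral of `s^p e^{-bs}` -/
noncomputable def auxP (ν b p x : ℝ) : ℝ :=
  ∫ u in Ioi (0:ℝ), u ^ (-ν) * ((u + x) ^ p * exp (-(b * (u + x))))

lemma auxP_mellin {ν b p η : ℝ} (hν : ν < 1) (hb : 0 < b) (hη : 0 < η) (hm : 0 < η - ν + p) :
    IntegrableOn (fun x => x ^ (η - 1) * auxP ν b (p - 1) x) (Ioi 0) ∧
    ∫ x in Ioi (0:ℝ), x ^ (η - 1) * auxP ν b (p - 1) x =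
      Gamma (1 - ν) * Gamma η / Gamma (1 - ν + η) * ((1 / b) ^ (η - ν + p) * Gamma (η - ν + p)) := by
  obtain ⟨b1, b2⟩ := aux_beta (p := 1 - ν) (q := η) (by linarith) hη
  have key := aux_swap
    (fun x v => (v ^ (-ν) * (1 + v) ^ (p - 1)) * (x ^ (η - ν + p - 1) * exp (-((b * (1 + v)) * x))))
    (fun v => v ^ (1 - ν - 1) * (1 + v) ^ (-(1 - ν + η)) *
      ((1 / b) ^ (η - ν + p) * Gamma (η - ν + p)))
    (by unfold Function.uncurry; fun_prop)
    (fun x hx v hv => by positivity)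
    (fun v hv => (aux_gamma_int hm (by positivity)).const_mul _)
    (fun v hv => by
      have hv' : (0:ℝ) < 1 + v := by linarith
      rw [integral_const_mul, integral_rpow_mul_exp_neg_mul_Ioi hm (by positivity),
        show 1 - ν - 1 = -ν by ring, show -(1 - ν + η) = (p - 1) + (-(η - ν + p)) by ring,
        rpow_add hv', rpow_neg hv'.le, ← inv_rpow hv'.le, one_div, one_div, mul_inv,
        mul_rpow (by positivity) (by positivity)]
      ring)
    (b1.mul_const _)
  have hin : ∀ x ∈ Ioi (0:ℝ), (∫ v in Ioi (0:ℝ), (v ^ (-ν) * (1 + v) ^ (p - 1)) *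
      (x ^ (η - ν + p - 1) * exp (-((b * (1 + v)) * x)))) = x ^ (η - 1) * auxP ν b (p - 1) x := by
    intro x hx
    have hx' : (0:ℝ) < x := hx
    have := integral_comp_mul_left_Ioi
      (fun u => u ^ (-ν) * ((u + x) ^ (p - 1) * exp (-(b * (u + x))))) 0 hx'
    rw [mul_zero, smul_eq_mul] at this
    rw [show auxP ν b (p - 1) x = x * (x⁻¹ * auxP ν b (p - 1) x) by field_simp]
    unfold auxP
    rw [← this, ← integral_const_mul, ← integral_const_mul]
    refine setIntegral_congr_fun measurableSet_Ioi (fun v hv => ?_)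
    have hv' : (0:ℝ) < v := hv
    rw [show x * v + x = x * (1 + v) by ring, mul_rpow hx'.le hv'.le,
      mul_rpow hx'.le (by positivity), show b * (x * (1 + v)) = b * (1 + v) * x by ring,
      show η - ν + p - 1 = (η - 1) + 1 + (-ν) + (p - 1) by ring, rpow_add hx', rpow_add hx',
      rpow_add hx', rpow_one]
    ring
  obtain ⟨k1, k2⟩ := key
  refine ⟨k1.congr_fun hin measurableSet_Ioi, ?_⟩
  rw [← setIntegral_congr_fun measurableSet_Ioi hin, k2, integral_mul_const, b2]

lemma aux_bound {b δ : ℝ} (p : ℝ) (hb : 0 < b) (hδ : 0 < δ) :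
    ∃ K : ℝ, 0 ≤ K ∧ ∀ s, δ ≤ s → s ^ p * exp (-(b * s)) ≤ K * exp (-(b / 2 * s)) := by
  set q := |p| + 1 with hq
  have hq0 : 0 < q := by positivity
  have hpq : p ≤ q := by have := le_abs_self p; linarith
  set c := b / 2 / q with hc
  have hc0 : 0 < c := by positivity
  refine ⟨δ ^ (p - q) * (1 / c) ^ q, by positivity, fun s hs => ?_⟩
  have hs0 : 0 < s := by linarith
  have h1 : s ^ p ≤ δ ^ (p - q) * s ^ q := by
    rw [show s ^ p = s ^ (p - q) * s ^ q by rw [← rpow_add hs0]; ring_nf]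
    exact mul_le_mul_of_nonneg_right (rpow_le_rpow_of_nonpos hδ hs (sub_nonpos.2 hpq)) (by positivity)
  have h2 : s ≤ 1 / c * exp (c * s) := by
    have := add_one_le_exp (c * s)
    rw [one_div, ← div_eq_inv_mul, le_div_iff₀ hc0]; linarith
  have h3 : s ^ q ≤ (1 / c) ^ q * exp (b / 2 * s) := by
    calc s ^ q ≤ (1 / c * exp (c * s)) ^ q := rpow_le_rpow hs0.le h2 hq0.le
      _ = _ := by
        rw [mul_rpow (by positivity) (by positivity), ← exp_mul, hc]
        congr 2; field_simp
  calc s ^ p * exp (-(b * s)) ≤ (δ ^ (p - q) * ((1 / c) ^ q * exp (b / 2 * s))) * exp (-(b * s)) := by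
        gcongr
        exact h1.trans (by gcongr)
    _ = _ := by
        rw [show -(b / 2 * s) = b / 2 * s + -(b * s) by ring, exp_add]; ring

lemma auxP_integrable {ν b x : ℝ} (p : ℝ) (hν : ν < 1) (hb : 0 < b) (hx : 0 < x) :
    IntegrableOn (fun u => u ^ (-ν) * ((u + x) ^ p * exp (-(b * (u + x))))) (Ioi 0) := by
  obtain ⟨K, hK, hb'⟩ := aux_bound p hb hx
  have := (aux_gamma_int (s := 1 - ν) (by linarith) (half_pos hb)).mul_const K
  refine Integrable.mono' this (by fun_prop) ?_
  refine (ae_restrict_iff' measurableSet_Ioi).2 (ae_of_all _ fun u hu => ?_)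
  have hu' : (0:ℝ) < u := hu
  rw [Real.norm_of_nonneg (by positivity), show 1 - ν - 1 = -ν by ring, mul_assoc]
  refine mul_le_mul_of_nonneg_left ?_ (by positivity)
  rw [mul_comm _ K]
  refine (hb' _ (by linarith)).trans ?_
  gcongr
  linarith

lemma auxP_deriv {ν b a x : ℝ} (hν : ν < 1) (hb : 0 < b) (hx : 0 < x) :
    HasDerivAt (auxP ν b a) (a * auxP ν b (a - 1) x - b * auxP ν b a x) x := by
  obtain ⟨K, hK, hKb⟩ := aux_bound a hb (half_pos hx)
  obtain ⟨L, hL, hLb⟩ := aux_bound (a - 1) hb (half_pos hx)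
  have hbd := (aux_gamma_int (s := 1 - ν) (by linarith) (half_pos hb)).mul_const (|a| * L + b * K)
  have hs : Ioi (x / 2) ∈ nhds x := Ioi_mem_nhds (by linarith)
  have key := hasDerivAt_integral_of_dominated_loc_of_deriv_le (𝕜 := ℝ)
    (μ := volume.restrict (Ioi (0:ℝ)))
    (F := fun y u => u ^ (-ν) * ((u + y) ^ a * exp (-(b * (u + y)))))
    (F' := fun y u => a * (u ^ (-ν) * ((u + y) ^ (a - 1) * exp (-(b * (u + y))))) -
      b * (u ^ (-ν) * ((u + y) ^ a * exp (-(b * (u + y)))))) hs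
    (Filter.Eventually.of_forall fun y => by fun_prop)
    (auxP_integrable a hν hb hx) (by fun_prop)
    (by
      refine (ae_restrict_iff' measurableSet_Ioi).2 (ae_of_all _ fun u hu y hy => ?_)
      have hu' : (0:ℝ) < u := hu
      have hy' : x / 2 < y := hy
      have hy0 : 0 < y := by linarith
      have e : exp (-(b / 2 * (u + y))) ≤ exp (-(b / 2 * u)) := by
        gcongr; linarith
      have h1 := (hLb (u + y) (by linarith)).trans (mul_le_mul_of_nonneg_left e hL)
      have h2 := (hKb (u + y) (by linarith)).trans (mul_le_mul_of_nonneg_left e hK)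
      refine (norm_sub_le _ _).trans ?_
      rw [norm_mul a, norm_mul b, Real.norm_eq_abs a, Real.norm_of_nonneg hb.le,
        Real.norm_of_nonneg (by positivity : 0 ≤ u ^ (-ν) * ((u + y) ^ (a - 1) * exp (-(b * (u + y))))),
        Real.norm_of_nonneg (by positivity : 0 ≤ u ^ (-ν) * ((u + y) ^ a * exp (-(b * (u + y)))))]
      calc _ ≤ |a| * (u ^ (-ν) * (L * exp (-(b / 2 * u)))) + b * (u ^ (-ν) * (K * exp (-(b / 2 * u)))) := by
            gcongr
        _ = u ^ (1 - ν - 1) * exp (-(b / 2 * u)) * (|a| * L + b * K) := by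
            rw [show 1 - ν - 1 = -ν by ring]; ring)
    hbd
    (by
      refine (ae_restrict_iff' measurableSet_Ioi).2 (ae_of_all _ fun u hu y hy => ?_)
      have hu' : (0:ℝ) < u := hu
      have hy' : x / 2 < y := hy
      have hy0 : 0 < u + y := by linarith
      have d0 : HasDerivAt (fun y => u + y) 1 y := (hasDerivAt_id y).const_add u
      have d1 := d0.rpow_const (p := a) (Or.inl hy0.ne')
      have d2 := ((d0.const_mul b).neg).exp
      convert! (d1.mul d2).const_mul (u ^ (-ν)) using 1
      simp only [Pi.neg_apply]
      ring)
  have h := key.2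
  rw [integral_sub ((auxP_integrable (a - 1) hν hb hx).const_mul a)
    ((auxP_integrable a hν hb hx).const_mul b), integral_const_mul, integral_const_mul] at h
  exact h

lemma aux_shift (ν : ℝ) (h : ℝ → ℝ) (y : ℝ) :
    ∫ s in Ioi y, (s - y) ^ (-ν) * h s = ∫ u in Ioi (0:ℝ), u ^ (-ν) * h (u + y) := by
  have := (measurePreserving_add_right (volume : Measure ℝ) y).setIntegral_preimage_emb
    (measurableEmbedding_addRight y) (fun s => (s - y) ^ (-ν) * h s) (Ioi y)
  rw [← this]
  simp

lemma aux_rl {ν b a C : ℝ} (hν : ν < 1) (hb : 0 < b) (h : ℝ → ℝ)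
    (hh : ∀ s > 0, h s = C * (s ^ a * exp (-(b * s)))) {x : ℝ} (hx : 0 < x) :
    rlRightDeriv ν h x =
      -(1 / Gamma (1 - ν)) * (C * (a * auxP ν b (a - 1) x - b * auxP ν b a x)) := by
  unfold rlRightDeriv
  congr 1
  refine HasDerivAt.deriv (((auxP_deriv (a := a) hν hb hx).const_mul C).congr_of_eventuallyEq ?_)
  filter_upwards [Ioi_mem_nhds hx] with y hy
  have hy' : (0:ℝ) < y := hy
  rw [aux_shift, auxP, ← integral_const_mul]
  refine setIntegral_congr_fun measurableSet_Ioi (fun u hu => ?_)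
  have hu' : (0:ℝ) < u := hu
  rw [hh _ (by linarith)]; ring

lemma auxP_zero {ν b x : ℝ} (hν : ν < 1) (hb : 0 < b) :
    auxP ν b 0 x = (1 / b) ^ (1 - ν) * Gamma (1 - ν) * exp (-(b * x)) := by
  rw [← integral_rpow_mul_exp_neg_mul_Ioi (by linarith) hb, ← integral_mul_const, auxP]
  refine setIntegral_congr_fun measurableSet_Ioi (fun u hu => ?_)
  rw [rpow_zero, show 1 - ν - 1 = -ν by ring, show -(b * (u + x)) = -(b * u) + -(b * x) by ring,
    exp_add]
  ring

/-- Mellin-transform computation in the proof of Theorem 3 of the paper: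
`∫_0^∞ x^(η-1) d^ν/d(-x)^ν ( x^(μ-1+ν) d^ν/d(-x)^ν ( x^(1-μ) g(x,t) ) ) dx
  = Γ(η)/Γ(η-ν) ⬝ Γ(η+μ-1)/Γ(μ) ⬝ t^(η-ν-1)`. -/
theorem mellin_right_fractional_operator (μ ν t η : ℝ) (hμ : 0 < μ)
    (hν : ν ∈ Set.Ioo (0:ℝ) 1) (ht : 0 < t)
    (hη : max ν (1 + ν - μ) < η) :
    (∫ x in Set.Ioi (0:ℝ), x ^ (η - 1) *
        rlRightDeriv ν
          (fun y => y ^ (μ - 1 + ν) *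
            rlRightDeriv ν (fun z => z ^ (1 - μ) * sqBesselDensity μ z t) y) x) =
      (Real.Gamma η / Real.Gamma (η - ν)) *
        (Real.Gamma (η + μ - 1) / Real.Gamma μ) * t ^ (η - ν - 1) := by
  obtain ⟨hν0, hν1⟩ := hν
  obtain ⟨hη1, hη2⟩ := max_lt_iff.1 hη
  have hη0 : 0 < η := by linarith
  have hb : 0 < 1 / t := by positivity
  have hGμ := Gamma_pos_of_pos hμ
  have hGν : 0 < Gamma (1 - ν) := Gamma_pos_of_pos (by linarith)
  have hGη : 0 < Gamma (η - ν) := Gamma_pos_of_pos (by linarith)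
  have h1 : ∀ z > 0, z ^ (1 - μ) * sqBesselDensity μ z t =
      1 / (Gamma μ * t ^ μ) * (z ^ (0:ℝ) * exp (-(1 / t * z))) := by
    intro z hz
    have e : z ^ (1 - μ) * z ^ (μ - 1) = 1 := by
      rw [← rpow_add hz]; simp
    unfold sqBesselDensity
    rw [rpow_zero, show -z / t = -(1 / t * z) by ring]
    linear_combination (exp (-(1 / t * z)) / (Gamma μ * t ^ μ)) * e
  have h2 : ∀ y > 0, y ^ (μ - 1 + ν) *
      rlRightDeriv ν (fun z => z ^ (1 - μ) * sqBesselDensity μ z t) y =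
      (1 / (Gamma μ * t ^ μ) * t ^ (-ν)) * (y ^ (μ - 1 + ν) * exp (-(1 / t * y))) := by
    intro y hy
    rw [aux_rl hν1 hb _ h1 hy, auxP_zero hν1 hb, one_div_one_div,
      show 1 - ν = 1 + -ν by ring, rpow_add ht, rpow_one]
    rw [show 1 - ν = 1 + -ν by ring] at hGν
    field_simp
    ring
  set C := 1 / (Gamma μ * t ^ μ) * t ^ (-ν) with hC
  set a := μ - 1 + ν with ha
  obtain ⟨i1, e1⟩ := auxP_mellin (p := a) hν1 hb hη0 (by linarith)
  obtain ⟨i2, e2⟩ := auxP_mellin (p := a + 1) hν1 hb hη0 (by linarith)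
  rw [add_sub_cancel_right] at i2 e2
  have h3 : ∀ x ∈ Ioi (0:ℝ), x ^ (η - 1) * rlRightDeriv ν
          (fun y => y ^ a *
            rlRightDeriv ν (fun z => z ^ (1 - μ) * sqBesselDensity μ z t) y) x =
      (-(1 / Gamma (1 - ν)) * C) * (a * (x ^ (η - 1) * auxP ν (1 / t) (a - 1) x) -
        1 / t * (x ^ (η - 1) * auxP ν (1 / t) a x)) := by
    intro x hx
    rw [aux_rl hν1 hb _ h2 hx]; ring
  rw [setIntegral_congr_fun measurableSet_Ioi h3, integral_const_mul,
    integral_sub (i1.const_mul a) (i2.const_mul (1 / t)), integral_const_mul, integral_const_mul,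
    e1, e2, one_div_one_div, show η - ν + (a + 1) = (η + μ - 1) + 1 by rw [ha]; ring,
    show η - ν + a = η + μ - 1 by rw [ha]; ring, Gamma_add_one (by linarith),
    show 1 - ν + η = (η - ν) + 1 by ring, Gamma_add_one (by linarith), rpow_add_one ht.ne',
    show η - ν - 1 = (η + μ - 1) + (-ν) + (-μ) by ring, rpow_add ht, rpow_add ht, hC,
    rpow_neg ht.le μ]
  have hd : η - ν ≠ 0 := by linarith
  field_simp
  rw [ha]; ring
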